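/- Moving an arrow not matched by a tree diagram does not change the pairing: let G and G' be Gauss diagrams on n strings with the same set of arrows except that one arrow g ∼ (i,j) of G is replaced by an arrow g' ∼ (i,j) of G' of the same sign in a possibly different position (as witnessed by a bijection of arrows preserving signs, head/tail string indices, and the relative order of all endpoints other than those of g and g'). If the tree diagram A ∈ 𝒜(n;t) has no arrow with head on string i and tail on string j, then ⟨A,G⟩ = ⟨A,G'⟩. -/

import Mathlib

open scoped BigOperators

/-!  Combinatorial framework for Gauss diagrams of (string) links and for the
Kravchenko–Polyak tree diagrams/tree invariants (following the paper
"Tree invariants and Milnor linking numbers with indeterminacy").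

Strings of a diagram on `n` strings are indexed by `1, …, n`; each string is
oriented downward from a basepoint at its top, and the position of an endpoint
on its string is a rational number which increases from top to bottom. -/

/-- A Gauss diagram on `n` strings: a finite type of signed arrows, each with a
head endpoint and a tail endpoint lying on strings `1,…,n`, all endpoints
distinct, the endpoints on each string being linearly ordered (top-to-bottom)
by their position. An endpoint is encoded as a pair `(g, b)` where `b = true`
designates the head of the arrow `g` and `b = false` its tail. -/
structure GaussDiagram (n : ℕ) where
  Arrow : Type
  fin : Fintype Arrow
  dec : DecidableEq Arrow
  /-- the string carrying the head of an arrow -/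
  hs : Arrow → ℕ
  /-- the string carrying the tail of an arrow -/
  ts : Arrow → ℕ
  /-- the position of the head on its string (positions increase downward) -/
  hp : Arrow → ℚ
  /-- the position of the tail on its string -/
  tp : Arrow → ℚ
  /-- the sign `ε(g) ∈ {+1, -1}` of an arrow -/
  sign : Arrow → ℤ
  hs_mem : ∀ g, hs g ∈ Finset.Icc 1 n
  ts_mem : ∀ g, ts g ∈ Finset.Icc 1 n
  sign_unit : ∀ g, sign g = 1 ∨ sign g = -1
  /-- all endpoints are distinct -/
  distinct : ∀ e e' : Arrow × Bool,
    (if e.2 then hs e.1 else ts e.1) = (if e'.2 then hs e'.1 else ts e'.1) →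
    (if e.2 then hp e.1 else tp e.1) = (if e'.2 then hp e'.1 else tp e'.1) →
    e = e'

attribute [instance] GaussDiagram.fin GaussDiagram.dec

namespace GaussDiagram

variable {n : ℕ}

/-- the string on which an endpoint lies -/
def estr (G : GaussDiagram n) (e : G.Arrow × Bool) : ℕ :=
  if e.2 then G.hs e.1 else G.ts e.1

/-- the position of an endpoint on its string -/
def epos (G : GaussDiagram n) (e : G.Arrow × Bool) : ℚ :=
  if e.2 then G.hp e.1 else G.tp e.1

end GaussDiagram

/-- The data of a tree diagram.  By axiom (d2), a tree diagram with leaves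
indexed by `I` and trunk `j` has exactly one arrow tailed at each string
`i ∈ I \ {j}`, so its arrows are canonically indexed by `I.erase j`:
`par i` is the string carrying the head of the arrow tailed at string `i`
(the "parent" string), and `rk i` is the rank (counted from the top, starting
at `0`) of the head of this arrow among all the arrowheads lying on the string
`par i`.  By axiom (d4) the tail on a string lies below all the heads on that
string, so `par` and `rk` determine the diagram up to isomorphism.  Junk
values are pinned by `par i = i` and `rk i = 0` outside `I.erase j`. -/
structure PreTree where
  par : ℕ → ℕ
  rk : ℕ → ℕ

namespace PreTree

/-- `A` is a tree diagram with leaves indexed by `I` and trunk `j`: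
axioms (d1)–(d4), together with canonicality of the ranks and the pinning of
junk values. -/
def IsTreeDiagram (I : Finset ℕ) (j : ℕ) (A : PreTree) : Prop :=
  (∀ i ∈ I.erase j, A.par i ∈ I ∧ A.par i ≠ i ∧
      A.rk i < (((I.erase j).filter fun b => A.par b = A.par i)).card) ∧
  (∀ i ∈ I.erase j, ∀ i' ∈ I.erase j,
      A.par i = A.par i' → A.rk i = A.rk i' → i = i') ∧
  (∀ i, i ∉ I.erase j → A.par i = i ∧ A.rk i = 0)

/-- `A` is planar: the associated rooted tree admits a planar embedding in
which the strings appear in increasing left-to-right order.  Concretely, the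
arrows can be drawn as horizontal segments at pairwise distinct heights
`h i` (heights increase downward), compatibly with the order of the endpoints
on each string, in such a way that no arrow crosses the retained part of an
intermediate string (in particular no arrow passes over the trunk). -/
def IsPlanar (I : Finset ℕ) (j : ℕ) (A : PreTree) : Prop :=
  ∃ h : ℕ → ℚ,
    (∀ i ∈ I.erase j, ∀ i' ∈ I.erase j, h i = h i' → i = i') ∧
    (∀ i ∈ I.erase j, ∀ i' ∈ I.erase j, A.par i = A.par i' →
        (A.rk i < A.rk i' ↔ h i < h i')) ∧
    (∀ i ∈ I.erase j, ∀ i' ∈ I.erase j, A.par i = i' → h i < h i') ∧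
    (∀ a ∈ I.erase j, ∀ k ∈ I, min (A.par a) a < k → k < max (A.par a) a →
        k ≠ j ∧ h k < h a)

end PreTree

/-- `𝒜(I;j)`: the set of planar tree diagrams with leaves indexed by `I` and
trunk `j`. -/
def TreeSet (I : Finset ℕ) (j : ℕ) : Set PreTree :=
  {A | A.IsTreeDiagram I j ∧ A.IsPlanar I j}

/-- `𝒜(n;r) = 𝒜({1,…,n};r)`. -/
def TreeSetFull (n r : ℕ) : Set PreTree :=
  TreeSet (Finset.Icc 1 n) r

/-- `sign(A) = (-1)^q` where `q` is the number of arrows of `A` pointing to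
the right, i.e. whose head lies on a higher-indexed string than the tail. -/
def treeSign (I : Finset ℕ) (j : ℕ) (A : PreTree) : ℤ :=
  (-1) ^ (((I.erase j).filter fun i => i < A.par i)).card

/-- A representation `φ` of the tree diagram `A` (with leaves `I`, trunk `j`)
in the Gauss diagram `G`: an injective map from the arrows of `A` (indexed by
their tail strings) to the arrows of `G`, preserving head strings, tail
strings, and the top-to-bottom order of the endpoints on each string. -/
def IsRep {n : ℕ} (G : GaussDiagram n) (I : Finset ℕ) (j : ℕ) (A : PreTree)
    (φ : {x // x ∈ I.erase j} → G.Arrow) : Prop :=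
  Function.Injective φ ∧
  (∀ a, G.hs (φ a) = A.par a.1) ∧
  (∀ a, G.ts (φ a) = a.1) ∧
  (∀ a a', A.par a.1 = A.par a'.1 →
      (A.rk a.1 < A.rk a'.1 ↔ G.hp (φ a) < G.hp (φ a'))) ∧
  (∀ a a', A.par a.1 = a'.1 → G.hp (φ a) < G.tp (φ a'))

/-- `sign(φ) = ∏_{α ∈ A} ε(φ(α))`. -/
noncomputable def repSign {n : ℕ} (G : GaussDiagram n) {s : Finset ℕ}
    (φ : {x // x ∈ s} → G.Arrow) : ℤ :=
  ∏ᶠ a, G.sign (φ a)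

/-- `⟨A,G⟩ = ∑_φ sign(φ)`, the sum over all representations of `A` in `G`. -/
noncomputable def pair {n : ℕ} (G : GaussDiagram n) (I : Finset ℕ) (j : ℕ)
    (A : PreTree) : ℤ :=
  ∑ᶠ (φ : {x // x ∈ I.erase j} → G.Arrow) (_ : IsRep G I j A φ), repSign G φ

/-- `⟨A,G⟩_{α ↦ g}`: the part of `⟨A,G⟩` coming from representations sending
the arrow `α` of `A` tailed at the string `a` to the arrow `g` of `G`. -/
noncomputable def pairTo {n : ℕ} (G : GaussDiagram n) (I : Finset ℕ) (j : ℕ)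
    (A : PreTree) (a : {x // x ∈ I.erase j}) (g : G.Arrow) : ℤ :=
  ∑ᶠ (φ : {x // x ∈ I.erase j} → G.Arrow) (_ : IsRep G I j A φ ∧ φ a = g),
    repSign G φ

/-- `⟨A,G⟩_{α ↛ g}`: the part of `⟨A,G⟩` coming from representations not
sending the arrow `α` of `A` tailed at the string `a` to the arrow `g`. -/
noncomputable def pairNotTo {n : ℕ} (G : GaussDiagram n) (I : Finset ℕ) (j : ℕ)
    (A : PreTree) (a : {x // x ∈ I.erase j}) (g : G.Arrow) : ℤ :=
  ∑ᶠ (φ : {x // x ∈ I.erase j} → G.Arrow) (_ : IsRep G I j A φ ∧ φ a ≠ g),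
    repSign G φ

/-- The tree pairing `⟨Z_{I;j},G⟩ = ∑_{A ∈ 𝒜(I;j)} sign(A)⟨A,G⟩`. -/
noncomputable def Zpair {n : ℕ} (G : GaussDiagram n) (I : Finset ℕ) (j : ℕ) : ℤ :=
  ∑ᶠ (A : PreTree) (_ : A ∈ TreeSet I j), treeSign I j A * pair G I j A

/-- `Δ_Z(I;·) = gcd{⟨Z_{J;k},G⟩ : J ⊊ I, k ∈ J}`. -/
noncomputable def DeltaZ {n : ℕ} (G : GaussDiagram n) (I : Finset ℕ) : ℤ :=
  (((I.powerset.erase I).sigma fun J => J)).gcd fun p => Zpair G p.1 p.2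
/-! ### Moves on Gauss diagrams -/

/-- The endpoints `e₁` and `e₂` (lying on a common string) are consecutive on
their string: no other endpoint lies strictly between them. -/
def Consecutive {n : ℕ} (G : GaussDiagram n) (e₁ e₂ : G.Arrow × Bool) : Prop :=
  ∀ e : G.Arrow × Bool, e ≠ e₁ → e ≠ e₂ → G.estr e = G.estr e₁ →
    ¬ (min (G.epos e₁) (G.epos e₂) < G.epos e ∧
        G.epos e < max (G.epos e₁) (G.epos e₂))

/-- `ψ` matches arrows of `G` with arrows of `G'` preserving signs, head
strings and tail strings. -/
def ArrowMap {n : ℕ} (G G' : GaussDiagram n) (ψ : G.Arrow → G'.Arrow) : Prop :=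
  (∀ g, G'.sign (ψ g) = G.sign g) ∧ (∀ g, G'.hs (ψ g) = G.hs g) ∧
  (∀ g, G'.ts (ψ g) = G.ts g)

/-- `ψ` preserves the relative (top-to-bottom) order of all pairs of endpoints
lying on a common string, except possibly for pairs meeting the set `S`. -/
def OrderPresOn {n : ℕ} (G G' : GaussDiagram n) (ψ : G.Arrow → G'.Arrow)
    (S : Set (G.Arrow × Bool)) : Prop :=
  ∀ e e' : G.Arrow × Bool, e ∉ S → e' ∉ S → G.estr e = G.estr e' →
    (G.epos e < G.epos e' ↔ G'.epos (ψ e.1, e.2) < G'.epos (ψ e'.1, e'.2))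

/-- Basepoint move: on one string, the topmost endpoint becomes the bottommost
endpoint of that string (or vice versa); all other data are unchanged. -/
def BasepointMove {n : ℕ} (G G' : GaussDiagram n) : Prop :=
  ∃ ψ : G.Arrow ≃ G'.Arrow, ArrowMap G G' ψ ∧
    ∃ e₀ : G.Arrow × Bool,
      OrderPresOn G G' ψ {e₀} ∧
      ((∀ e, e ≠ e₀ → G.estr e = G.estr e₀ →
          G.epos e₀ < G.epos e ∧ G'.epos (ψ e.1, e.2) < G'.epos (ψ e₀.1, e₀.2)) ∨
       (∀ e, e ≠ e₀ → G.estr e = G.estr e₀ →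
          G.epos e < G.epos e₀ ∧ G'.epos (ψ e₀.1, e₀.2) < G'.epos (ψ e.1, e.2)))

/-- Insertion of an isolated arrow `g₀` whose head and tail are consecutive
endpoints on a single string (first Reidemeister move). -/
def R1Ins {n : ℕ} (G G' : GaussDiagram n) : Prop :=
  ∃ (ψ : G.Arrow → G'.Arrow) (g₀ : G'.Arrow),
    Function.Injective ψ ∧ ArrowMap G G' ψ ∧ OrderPresOn G G' ψ ∅ ∧
    (∀ g, ψ g ≠ g₀) ∧ (∀ h, h ≠ g₀ → ∃ g, ψ g = h) ∧
    G'.hs g₀ = G'.ts g₀ ∧ Consecutive G' (g₀, true) (g₀, false)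

/-- First Reidemeister move (insertion or deletion). -/
def R1Move {n : ℕ} (G G' : GaussDiagram n) : Prop :=
  R1Ins G G' ∨ R1Ins G' G

/-- Insertion of a parallel pair `g₊, g₋` of arrows of opposite signs, with
heads consecutive on a common string and tails consecutive on a common string,
in parallel position (second Reidemeister move). -/
def R2Ins {n : ℕ} (G G' : GaussDiagram n) : Prop :=
  ∃ (ψ : G.Arrow → G'.Arrow) (gp gm : G'.Arrow),
    Function.Injective ψ ∧ ArrowMap G G' ψ ∧ OrderPresOn G G' ψ ∅ ∧
    gp ≠ gm ∧ (∀ g, ψ g ≠ gp ∧ ψ g ≠ gm) ∧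
    (∀ h, h ≠ gp → h ≠ gm → ∃ g, ψ g = h) ∧
    G'.sign gp = - G'.sign gm ∧ G'.hs gp = G'.hs gm ∧ G'.ts gp = G'.ts gm ∧
    Consecutive G' (gp, true) (gm, true) ∧
    Consecutive G' (gp, false) (gm, false) ∧
    (G'.hp gp < G'.hp gm ↔ G'.tp gp < G'.tp gm)

/-- Second Reidemeister move (insertion or deletion). -/
def R2Move {n : ℕ} (G G' : GaussDiagram n) : Prop :=
  R2Ins G G' ∨ R2Ins G' G

/-- Third Reidemeister move: the three designated pairs of consecutive
endpoints of the positive arrows `g ∼ (i₁,i₂)`, `h ∼ (i₁,i₃)`, `k ∼ (i₂,i₃)`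
have their relative order reversed, all other relative orders of endpoints
being preserved. -/
def R3Move {n : ℕ} (G G' : GaussDiagram n) : Prop :=
  ∃ (ψ : G.Arrow ≃ G'.Arrow) (g h k : G.Arrow),
    ArrowMap G G' ψ ∧
    g ≠ h ∧ g ≠ k ∧ h ≠ k ∧
    G.sign g = 1 ∧ G.sign h = 1 ∧ G.sign k = 1 ∧
    G.hs h = G.hs g ∧ G.hs k = G.ts g ∧ G.ts k = G.ts h ∧
    Consecutive G (g, true) (h, true) ∧
    Consecutive G (g, false) (k, true) ∧
    Consecutive G (h, false) (k, false) ∧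
    (G.epos (g, true) < G.epos (h, true) ↔
      G'.epos (ψ h, true) < G'.epos (ψ g, true)) ∧
    (G.epos (g, false) < G.epos (k, true) ↔
      G'.epos (ψ k, true) < G'.epos (ψ g, false)) ∧
    (G.epos (h, false) < G.epos (k, false) ↔
      G'.epos (ψ k, false) < G'.epos (ψ h, false)) ∧
    (∀ e e' : G.Arrow × Bool, G.estr e = G.estr e' →
      ¬ (({e, e'} : Set (G.Arrow × Bool)) = {(g, true), (h, true)} ∨
         ({e, e'} : Set (G.Arrow × Bool)) = {(g, false), (k, true)} ∨
         ({e, e'} : Set (G.Arrow × Bool)) = {(h, false), (k, false)}) →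
      (G.epos e < G.epos e' ↔ G'.epos (ψ e.1, e.2) < G'.epos (ψ e'.1, e'.2)))

/-- `G` and `G'` have identical sets of arrows with head and tail on distinct
strings (same signs, same head/tail strings, same relative order of the
endpoints of these arrows on each string); they may differ arbitrarily in
arrows whose head and tail lie on the same string.  This is the equivalence
generated by the self-arrow moves (insertion, deletion, sign change of an
arrow with both endpoints on one string). -/
def MixedEquiv {n : ℕ} (G G' : GaussDiagram n) : Prop :=
  ∃ ψ : {g : G.Arrow // G.hs g ≠ G.ts g} ≃ {g : G'.Arrow // G'.hs g ≠ G'.ts g},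
    (∀ g, G'.sign (ψ g).1 = G.sign g.1) ∧
    (∀ g, G'.hs (ψ g).1 = G.hs g.1) ∧
    (∀ g, G'.ts (ψ g).1 = G.ts g.1) ∧
    (∀ (g g' : {g : G.Arrow // G.hs g ≠ G.ts g}) (b b' : Bool),
      G.estr (g.1, b) = G.estr (g'.1, b') →
      (G.epos (g.1, b) < G.epos (g'.1, b') ↔
        G'.epos ((ψ g).1, b) < G'.epos ((ψ g').1, b')))

/-- A single arrow `g` of `G` is replaced by the arrow `g' = ψ g` of `G'` with
the same sign, head string and tail string, in a possibly different position;
all other arrows and all relative orders of their endpoints are unchanged. -/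
def MovedArrow {n : ℕ} (G G' : GaussDiagram n) (g : G.Arrow) (g' : G'.Arrow) :
    Prop :=
  ∃ ψ : G.Arrow ≃ G'.Arrow, ψ g = g' ∧ ArrowMap G G' ψ ∧
    ∀ e e' : G.Arrow × Bool, e.1 ≠ g → e'.1 ≠ g → G.estr e = G.estr e' →
      (G.epos e < G.epos e' ↔ G'.epos (ψ e.1, e.2) < G'.epos (ψ e'.1, e'.2))
/-! ### Stacking of planar tree diagrams -/

/-- Relabelling of the strings of `P` (a planar tree diagram on the strings
`1,…,n` with trunk `r`) when a diagram on `m` strings with trunk `s` is stacked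
onto its `k`-th leaf: strings left of `k` keep their index, the `k`-th string
is glued onto the trunk of the stacked diagram (index `k+s-1`), and strings
right of `k` are shifted by `m-1`. -/
def embP (k m s p : ℕ) : ℕ :=
  if p < k then p else if p = k then k + s - 1 else p + m - 1

/-- The inverse relabelling: the string of `P` from which the string `i` of
`P ≺ₖ Q` originates. -/
def invP (k m s i : ℕ) : ℕ :=
  if i < k then i else if i = k + s - 1 then k else i - (m - 1)

/-- The number of arrowheads lying on the trunk string of the tree diagram `Q`
on `m` strings with trunk `s`. -/
def qcount (m s : ℕ) (Q : PreTree) : ℕ :=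
  ((((Finset.Icc 1 m).erase s)).filter fun q => Q.par q = s).card

/-- The stacking `P ≺ₖ Q` of the tree diagram `Q` (on `m` strings, trunk `s`)
onto the `k`-th leaf of the tree diagram `P`: the trunk string of `Q` is glued
onto the `k`-th leaf string of `P` (the arrows of `Q` lying above those of `P`
on the glued string) and the resulting strings are renumbered `1,…,n+m-1` in
left-to-right planar order, the strings of `Q` occupying positions
`k,…,k+m-1`. -/
def stack (k m s : ℕ) (P Q : PreTree) : PreTree where
  par i :=
    if k ≤ i ∧ i ≤ k + m - 1 ∧ i ≠ k + s - 1 then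
      k + Q.par (i - k + 1) - 1
    else
      embP k m s (P.par (invP k m s i))
  rk i :=
    if k ≤ i ∧ i ≤ k + m - 1 ∧ i ≠ k + s - 1 then
      Q.rk (i - k + 1)
    else if P.par (invP k m s i) = k ∧ invP k m s i ≠ k then
      P.rk (invP k m s i) + qcount m s Q
    else
      P.rk (invP k m s i)

/-- The trunk of `P ≺ₖ Q` (where `P` has trunk `r` and `Q` has `m` strings and
trunk `s`). -/
def stackTrunk (r k m s : ℕ) : ℕ :=
  if r < k then r else if k < r then r + m - 1 else k + s - 1

/-- The elementary tree `e ∈ 𝒜(2;1)`: one arrow with head on string `1` (the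
trunk) and tail on string `2`. -/
def etree : PreTree :=
  ⟨fun i => if i = 2 then 1 else i, fun _ => 0⟩

/-- The elementary tree `ē ∈ 𝒜(2;2)`: one arrow with head on string `2` (the
trunk) and tail on string `1`. -/
def ebar : PreTree :=
  ⟨fun i => if i = 1 then 2 else i, fun _ => 0⟩

/-- The `k`-th smallest element of the finite set `I` (`1`-indexed). -/
def enumIn (I : Finset ℕ) (k : ℕ) : ℕ :=
  (I.sort (· ≤ ·)).getD (k - 1) 0

/-- The (`1`-indexed) rank of `x` in the finite set `I`. -/
def rankIn (I : Finset ℕ) (x : ℕ) : ℕ :=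
  ((I.filter fun y => y ≤ x)).card

/-- Relabel a tree diagram on the strings `1,…,|I|` so that its strings are
indexed by the elements of `I` (in increasing order); this realizes a tree
diagram `A' ∈ 𝒜(I;·)` from `A ∈ 𝒜(|I|;·)` as in the pairing `⟨A, G(I)⟩`. -/
def relabel (I : Finset ℕ) (P : PreTree) : PreTree where
  par x := if x ∈ I then enumIn I (P.par (rankIn I x)) else x
  rk x := if x ∈ I then P.rk (rankIn I x) else 0
/-- Composing with an arrow bijection which preserves strings, and preserves the order of the
endpoints of every arrow that can be matched by `A`, preserves being a representation. -/
theorem isRep_comp_iff {n : ℕ} {G G' : GaussDiagram n} {I : Finset ℕ} {j : ℕ} {A : PreTree}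
    {ψ : G.Arrow ≃ G'.Arrow} (hψ : ArrowMap G G' ψ) {g : G.Arrow}
    (hord : ∀ e e' : G.Arrow × Bool, e.1 ≠ g → e'.1 ≠ g → G.estr e = G.estr e' →
      (G.epos e < G.epos e' ↔ G'.epos (ψ e.1, e.2) < G'.epos (ψ e'.1, e'.2)))
    (hno : ¬ ∃ b ∈ I.erase j, b = G.ts g ∧ A.par b = G.hs g)
    (φ : {x // x ∈ I.erase j} → G.Arrow) :
    IsRep G' I j A (ψ ∘ φ) ↔ IsRep G I j A φ := by
  obtain ⟨-, hhs, hts⟩ := hψ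
  simp only [IsRep, Function.comp_apply, hhs, hts, ψ.injective.of_comp_iff]
  refine and_congr_right fun _ => and_congr_right fun hh => and_congr_right fun ht => ?_
  have hne (a) : φ a ≠ g := fun h => hno ⟨a.1, a.2, h ▸ (ht a).symm, h ▸ (hh a).symm⟩
  refine and_congr (forall₃_congr fun a a' hp => iff_congr Iff.rfl ?_)
    (forall₃_congr fun a a' hp => ?_)
  · exact (hord (φ a, true) (φ a', true) (hne a) (hne a')
      (by simp [GaussDiagram.estr, hh, hp])).symm
  · exact (hord (φ a, true) (φ a', false) (hne a) (hne a')
      (by simp [GaussDiagram.estr, hh, ht, hp])).symm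

/-- **Moving an arrow not matched by a tree diagram does not change the
pairing.**  Let `G` and `G'` have the same arrows except that the arrow
`g ∼ (i,j)` of `G` is replaced by the arrow `g' ∼ (i,j)` of `G'` of the same
sign in a possibly different position.  If the tree diagram `A ∈ 𝒜(n;t)` has
no arrow with head on the string `i` and tail on the string `j`, then
`⟨A,G⟩ = ⟨A,G'⟩`. -/
theorem moved_arrow_unmatched (n : ℕ) (G G' : GaussDiagram n)
    (g : G.Arrow) (g' : G'.Arrow) (hmv : MovedArrow G G' g g')
    (t : ℕ) (A : PreTree) (hA : A ∈ TreeSet (Finset.Icc 1 n) t)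
    (hno : ¬ ∃ b ∈ (Finset.Icc 1 n).erase t,
        b = G.ts g ∧ A.par b = G.hs g) :
    pair G (Finset.Icc 1 n) t A = pair G' (Finset.Icc 1 n) t A := by
  obtain ⟨ψ, -, hψ, hord⟩ := hmv
  refine finsum_eq_of_bijective (ψ ∘ ·)
    ((Equiv.refl {x // x ∈ (Finset.Icc 1 n).erase t}).arrowCongr ψ).bijective fun φ => ?_
  refine finsum_congr_Prop (propext (isRep_comp_iff hψ hord hno φ).symm) fun _ => ?_
  simp only [repSign, Function.comp_apply, hψ.1]
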